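/- UME-learnability is closed under countable unions: if Q_1, Q_2, Q_3, … are collections of probability measures on {0,1}^ℕ, each of which is UME-learnable, then the union Q = ⋃_{i∈ℕ} Q_i is UME-learnable. -/

import Mathlib

open MeasureTheory Filter

/-- The sup-distance `‖p − q‖_∞ = ⨆ j, |p j − q j|` between two vectors. -/
noncomputable def supDist {ι : Type*} (p q : ι → ℝ) : ℝ := ⨆ j, |p j - q j|

/-- The mean vector of a measure on `{0,1}^ι`: `Mean(μ)_j = μ {x | x j = 1}`. -/
noncomputable def meanVec {ι : Type*} (μ : Measure (ι → Bool)) : ι → ℝ :=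
  fun j => (μ {x | x j = true}).toReal

/-- UME-learnability of a collection of distributions on `{0,1}^ι`. -/
def UMELearnable {ι : Type*} (Q : Set (Measure (ι → Bool))) : Prop :=
  ∃ A : (n : ℕ) → (Fin n → (ι → Bool)) → ι → ℝ,
    (∀ n, Measurable (A n)) ∧
    (∀ n S j, A n S j ∈ Set.Icc (0 : ℝ) 1) ∧
    ∀ μ ∈ Q,
      Tendsto (fun n : ℕ =>
          ∫ S, supDist (A n S) (meanVec μ) ∂(Measure.pi fun _ : Fin n => μ))
        atTop (nhds 0)

section SupDist

variable {ι : Type*} {p q : ι → ℝ}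

lemma abs_sub_le_one_of_mem_Icc {x y : ℝ} (hx : x ∈ Set.Icc (0 : ℝ) 1)
    (hy : y ∈ Set.Icc (0 : ℝ) 1) : |x - y| ≤ 1 := by
  rw [abs_le]
  exact ⟨by linarith [hx.1, hy.2], by linarith [hx.2, hy.1]⟩

lemma abs_sub_le_supDist (hp : ∀ j, p j ∈ Set.Icc (0 : ℝ) 1) (hq : ∀ j, q j ∈ Set.Icc (0 : ℝ) 1)
    (j : ι) : |p j - q j| ≤ supDist p q :=
  le_ciSup (f := fun j => |p j - q j|)
    ⟨1, Set.forall_mem_range.2 fun j => abs_sub_le_one_of_mem_Icc (hp j) (hq j)⟩ j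

lemma supDist_nonneg (p q : ι → ℝ) : 0 ≤ supDist p q :=
  Real.iSup_nonneg fun _ => abs_nonneg _

lemma supDist_le [Nonempty ι] {c : ℝ} (h : ∀ j, |p j - q j| ≤ c) : supDist p q ≤ c :=
  ciSup_le h

lemma measurable_supDist [Countable ι] :
    Measurable fun x : (ι → ℝ) × (ι → ℝ) => supDist x.1 x.2 :=
  Measurable.iSup fun j => by fun_prop

lemma exists_half_supDist_le [Nonempty ι] (p q : ι → ℝ) :
    ∃ j, supDist p q / 2 ≤ |p j - q j| := by
  rcases (supDist_nonneg p q).eq_or_lt with h | h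
  · exact ⟨Classical.arbitrary ι, by rw [← h]; simp⟩
  · obtain ⟨j, hj⟩ := exists_lt_of_lt_ciSup (show supDist p q / 2 < ⨆ j, |p j - q j| from
      half_lt_self h)
    exact ⟨j, hj.le⟩

end SupDist

section Selection

open Classical in
/-- The first coordinate at which `p` and `q` differ by at least half their sup-distance. -/
noncomputable def discrepancyIndex (p q : ℕ → ℝ) : ℕ := Nat.find (exists_half_supDist_le p q)

lemma half_supDist_le_discrepancyIndex (p q : ℕ → ℝ) :
    supDist p q / 2 ≤ |p (discrepancyIndex p q) - q (discrepancyIndex p q)| := by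
  classical
  exact Nat.find_spec (exists_half_supDist_le p q)

lemma measurable_discrepancyIndex :
    Measurable fun x : (ℕ → ℝ) × (ℕ → ℝ) => discrepancyIndex x.1 x.2 := by
  classical
  exact measurable_find (fun x : (ℕ → ℝ) × (ℕ → ℝ) => exists_half_supDist_le x.1 x.2) fun j =>
    measurableSet_le (measurable_supDist.div_const 2) (by fun_prop)

/-- The largest disagreement between the candidate `P a` and the reference vector `r` over the
discrepancy coordinates of pairs among the first `k + 1` candidates. -/
noncomputable def candidateScore (k : ℕ) (P : ℕ → ℕ → ℝ) (r : ℕ → ℝ) (a : ℕ) : ℝ :=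
  supDist (fun b : Fin (k + 1) × Fin (k + 1) => P a (discrepancyIndex (P b.1) (P b.2)))
    (fun b => r (discrepancyIndex (P b.1) (P b.2)))

lemma measurable_eval_nat {Ω β : Type*} [MeasurableSpace Ω] [MeasurableSpace β]
    {f : Ω → ℕ → β} {g : Ω → ℕ} (hf : Measurable f) (hg : Measurable g) :
    Measurable fun ω => f ω (g ω) := by
  have : Measurable fun x : (ℕ → β) × ℕ => x.1 x.2 :=
    measurable_from_prod_countable_left fun j => measurable_pi_apply j
  exact this.comp (hf.prodMk hg)

lemma measurable_candidateScore (k a : ℕ) :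
    Measurable fun x : (ℕ → ℕ → ℝ) × (ℕ → ℝ) => candidateScore k x.1 x.2 a := by
  have hJ (b c : ℕ) : Measurable fun x : (ℕ → ℕ → ℝ) × (ℕ → ℝ) =>
      discrepancyIndex (x.1 b) (x.1 c) :=
    measurable_discrepancyIndex.comp
      (f := fun x : (ℕ → ℕ → ℝ) × (ℕ → ℝ) => (x.1 b, x.1 c))
      (((measurable_pi_apply b).comp measurable_fst).prodMk
        ((measurable_pi_apply c).comp measurable_fst))
  refine measurable_supDist.comp (Measurable.prodMk ?_ ?_)
  · exact measurable_pi_lambda _ fun b =>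
      measurable_eval_nat ((measurable_pi_apply a).comp measurable_fst) (hJ _ _)
  · exact measurable_pi_lambda _ fun b => measurable_eval_nat measurable_snd (hJ _ _)

lemma exists_candidateScore_minimal (k : ℕ) (P : ℕ → ℕ → ℝ) (r : ℕ → ℝ) :
    ∃ a, a ≤ k ∧ ∀ b ≤ k, candidateScore k P r a ≤ candidateScore k P r b := by
  obtain ⟨a, ha, h⟩ := Finset.exists_min_image (Finset.range (k + 1)) (candidateScore k P r) (by simp)
  simp only [Finset.mem_range, Nat.lt_succ_iff] at ha h
  exact ⟨a, ha, h⟩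

open Classical in
/-- The first index minimizing the score among the first `k + 1` candidates. -/
noncomputable def selectedIndex (k : ℕ) (P : ℕ → ℕ → ℝ) (r : ℕ → ℝ) : ℕ :=
  Nat.find (exists_candidateScore_minimal k P r)

lemma selectedIndex_spec (k : ℕ) (P : ℕ → ℕ → ℝ) (r : ℕ → ℝ) :
    selectedIndex k P r ≤ k ∧
      ∀ b ≤ k, candidateScore k P r (selectedIndex k P r) ≤ candidateScore k P r b := by
  classical
  exact Nat.find_spec (exists_candidateScore_minimal k P r)

lemma measurable_selectedIndex (k : ℕ) :
    Measurable fun x : (ℕ → ℕ → ℝ) × (ℕ → ℝ) => selectedIndex k x.1 x.2 := by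
  classical
  refine measurable_find
    (fun x : (ℕ → ℕ → ℝ) × (ℕ → ℝ) => exists_candidateScore_minimal k x.1 x.2) fun a => ?_
  simp only [Set.ofPred_and, Set.ofPred_forall]
  exact (MeasurableSet.const _).inter <| MeasurableSet.iInter fun b => MeasurableSet.iInter fun _ =>
    measurableSet_le (measurable_candidateScore k a) (measurable_candidateScore k b)

lemma measurable_selected (k : ℕ) :
    Measurable fun x : (ℕ → ℕ → ℝ) × (ℕ → ℝ) => x.1 (selectedIndex k x.1 x.2) :=
  measurable_eval_nat measurable_fst (measurable_selectedIndex k)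

/-- The selected candidate is nearly as close to `q` as any other candidate, up to the error of the
reference vector `r` at the discrepancy coordinates. -/
lemma supDist_selected_le {k i : ℕ} (hi : i ≤ k) {P : ℕ → ℕ → ℝ} {q r : ℕ → ℝ}
    (hP : ∀ a j, P a j ∈ Set.Icc (0 : ℝ) 1) (hq : ∀ j, q j ∈ Set.Icc (0 : ℝ) 1)
    (hr : ∀ j, r j ∈ Set.Icc (0 : ℝ) 1) :
    supDist (P (selectedIndex k P r)) q ≤ 5 * supDist (P i) q +
      4 * ∑ b : Fin (k + 1) × Fin (k + 1), |r (discrepancyIndex (P b.1) (P b.2)) -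
        q (discrepancyIndex (P b.1) (P b.2))| := by
  obtain ⟨hak, hmin⟩ := selectedIndex_spec k P r
  set a := selectedIndex k P r
  set D := ∑ b : Fin (k + 1) × Fin (k + 1), |r (discrepancyIndex (P b.1) (P b.2)) -
        q (discrepancyIndex (P b.1) (P b.2))|
  have hDb (b : Fin (k + 1) × Fin (k + 1)) : |r (discrepancyIndex (P b.1) (P b.2)) -
        q (discrepancyIndex (P b.1) (P b.2))| ≤ D :=
    Finset.single_le_sum (f := fun b : Fin (k + 1) × Fin (k + 1) =>
      |r (discrepancyIndex (P b.1) (P b.2)) - q (discrepancyIndex (P b.1) (P b.2))|)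
      (fun _ _ => abs_nonneg _) (Finset.mem_univ b)
  have hscore : candidateScore k P r i ≤ supDist (P i) q + D := by
    refine supDist_le fun b => ?_
    have h1 := abs_sub_le_supDist (hP i) hq (discrepancyIndex (P b.1) (P b.2))
    have h2 := hDb b
    rw [abs_sub_comm] at h2
    exact (abs_sub_le _ _ _).trans (add_le_add h1 h2)
  have ha := (hmin i hi).trans hscore
  let b : Fin (k + 1) × Fin (k + 1) := (⟨a, Nat.lt_succ_of_le hak⟩, ⟨i, Nat.lt_succ_of_le hi⟩)
  have h1 := half_supDist_le_discrepancyIndex (P a) (P i)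
  have h2 : |P a (discrepancyIndex (P a) (P i)) - r (discrepancyIndex (P a) (P i))| ≤
      candidateScore k P r a :=
    abs_sub_le_supDist
      (p := fun b : Fin (k + 1) × Fin (k + 1) => P a (discrepancyIndex (P b.1) (P b.2)))
      (q := fun b => r (discrepancyIndex (P b.1) (P b.2))) (fun _ => hP _ _) (fun _ => hr _) b
  have h3 : |r (discrepancyIndex (P a) (P i)) - q (discrepancyIndex (P a) (P i))| ≤ D := hDb b
  have h4 := abs_sub_le_supDist (hP i) hq (discrepancyIndex (P a) (P i))
  rw [abs_sub_comm] at h4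
  have h5 := abs_sub_le (P a (discrepancyIndex (P a) (P i))) (r (discrepancyIndex (P a) (P i)))
    (P i (discrepancyIndex (P a) (P i)))
  have h6 := abs_sub_le (r (discrepancyIndex (P a) (P i))) (q (discrepancyIndex (P a) (P i)))
    (P i (discrepancyIndex (P a) (P i)))
  refine supDist_le fun j => ?_
  have h7 := abs_sub_le (P a j) (P i j) (q j)
  have h8 := abs_sub_le_supDist (hP a) (hP i) j
  have h9 := abs_sub_le_supDist (hP i) hq j
  linarith

end Selection

section Empirical

/-- The vector of empirical frequencies of a sample. -/
noncomputable def empiricalMean {m : ℕ} {ι : Type*} (S : Fin m → ι → Bool) (j : ι) : ℝ :=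
  (∑ i, if S i j = true then (1 : ℝ) else 0) / m

lemma measurableSet_eval_eq_true {ι : Type*} (j : ι) :
    MeasurableSet {x : ι → Bool | x j = true} :=
  measurableSet_eq_fun (measurable_pi_apply j) measurable_const

lemma measurable_ite_eval {ι : Type*} (j : ι) :
    Measurable fun x : ι → Bool => if x j = true then (1 : ℝ) else 0 :=
  Measurable.ite (measurableSet_eval_eq_true j) measurable_const measurable_const

lemma measurable_empiricalMean {m : ℕ} {ι : Type*} :
    Measurable fun S : Fin m → ι → Bool => empiricalMean S :=
  measurable_pi_lambda _ fun j => Measurable.div_const (Finset.measurable_sum _ fun i _ =>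
    (measurable_ite_eval j).comp (measurable_pi_apply i)) _

lemma empiricalMean_mem_Icc {m : ℕ} {ι : Type*} (S : Fin m → ι → Bool) (j : ι) :
    empiricalMean S j ∈ Set.Icc (0 : ℝ) 1 := by
  refine ⟨div_nonneg (Finset.sum_nonneg fun i _ => by split_ifs <;> simp) (Nat.cast_nonneg m),
    div_le_one_of_le₀ ?_ (Nat.cast_nonneg m)⟩
  calc (∑ i, if S i j = true then (1 : ℝ) else 0) ≤ ∑ _i : Fin m, (1 : ℝ) :=
        Finset.sum_le_sum fun i _ => by split_ifs <;> simp
    _ = m := by simp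

lemma meanVec_mem_Icc {ι : Type*} (μ : Measure (ι → Bool)) [IsProbabilityMeasure μ] (j : ι) :
    meanVec μ j ∈ Set.Icc (0 : ℝ) 1 :=
  ⟨ENNReal.toReal_nonneg, measureReal_le_one⟩

lemma integrable_of_measurable_of_mem_Icc {Ω : Type*} [MeasurableSpace Ω] {μ : Measure Ω}
    [IsFiniteMeasure μ] {f : Ω → ℝ} (hf : Measurable f) {c d : ℝ}
    (hfb : ∀ ω, f ω ∈ Set.Icc c d) : Integrable f μ :=
  Integrable.of_mem_Icc c d hf.aemeasurable (ae_of_all _ hfb)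

lemma integral_ite_eval {ι : Type*} (μ : Measure (ι → Bool)) (j : ι) :
    ∫ x, (if x j = true then (1 : ℝ) else 0) ∂μ = meanVec μ j := by
  have := integral_indicator_one (μ := μ) (measurableSet_eval_eq_true j)
  simpa [Set.indicator_apply, meanVec, Measure.real] using this

lemma integral_sq_empiricalMean_sub_le {ι : Type*} (μ : Measure (ι → Bool))
    [IsProbabilityMeasure μ] {m : ℕ} (hm : 0 < m) (j : ι) :
    ∫ S, (empiricalMean S j - meanVec μ j) ^ 2 ∂(Measure.pi fun _ : Fin m => μ) ≤ 1 / m := by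
  have hm' : (0 : ℝ) < m := Nat.cast_pos.2 hm
  let X : (ι → Bool) → ℝ := fun x => if x j = true then 1 else 0
  have hXm : Measurable X := measurable_ite_eval j
  have hXb (x) : X x ∈ Set.Icc (0 : ℝ) 1 := by
    simp only [X]; split_ifs <;> simp
  have hXL : MemLp X 2 μ := memLp_of_bounded (ae_of_all _ hXb) hXm.aestronglyMeasurable 2
  have hvar := ProbabilityTheory.variance_sum_pi (μ := fun _ : Fin m => μ) (X := fun _ => X)
    fun _ => hXL
  have hone : ProbabilityTheory.variance X μ ≤ 1 := by
    refine (ProbabilityTheory.variance_le_sq_of_bounded (ae_of_all _ hXb) hXm.aemeasurable).trans ?_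
    norm_num
  have hmean : ∫ S, (∑ i, X (S i)) ∂(Measure.pi fun _ : Fin m => μ) = m * meanVec μ j := by
    rw [integral_finsetSum]
    · have (i : Fin m) : ∫ S, X (S i) ∂(Measure.pi fun _ : Fin m => μ) = meanVec μ j := by
        rw [integral_comp_eval (μ := fun _ : Fin m => μ) (i := i) hXm.aestronglyMeasurable]
        exact integral_ite_eval μ j
      simp [this]
    · exact fun i _ => integrable_of_measurable_of_mem_Icc (hXm.comp (measurable_pi_apply i))
        fun S => hXb (S i)
  have hsum : (∑ i, fun S : Fin m → ι → Bool => X (S i)) = fun S => ∑ i, X (S i) := by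
    ext S; simp
  have hsm : Measurable fun S : Fin m → ι → Bool => ∑ i, X (S i) :=
    Finset.measurable_sum _ fun i _ => hXm.comp (measurable_pi_apply i)
  rw [hsum, ProbabilityTheory.variance_eq_integral hsm.aemeasurable, hmean] at hvar
  have hrw : ∀ S : Fin m → ι → Bool, (empiricalMean S j - meanVec μ j) ^ 2 =
      (∑ i, X (S i) - m * meanVec μ j) ^ 2 / m ^ 2 := by
    intro S
    simp only [empiricalMean, X]
    field_simp
  simp_rw [hrw, integral_div]
  rw [hvar, div_le_div_iff₀ (by positivity) hm']
  have : ∑ _i : Fin m, ProbabilityTheory.variance X μ ≤ m := by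
    simpa using mul_le_mul_of_nonneg_left hone hm'.le
  nlinarith

lemma integral_abs_empiricalMean_sub_le {ι : Type*} (μ : Measure (ι → Bool))
    [IsProbabilityMeasure μ] {m : ℕ} (hm : 0 < m) (j : ι) :
    ∫ S, |empiricalMean S j - meanVec μ j| ∂(Measure.pi fun _ : Fin m => μ) ≤ 1 / √m := by
  have hs : 0 < √(m : ℝ) := Real.sqrt_pos.2 (Nat.cast_pos.2 hm)
  have hmeas : Measurable fun S : Fin m → ι → Bool => empiricalMean S j - meanVec μ j :=
    ((measurable_pi_apply j).comp measurable_empiricalMean).sub_const _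
  have hb (S : Fin m → ι → Bool) : |empiricalMean S j - meanVec μ j| ≤ 1 :=
    abs_sub_le_one_of_mem_Icc (empiricalMean_mem_Icc S j) (meanVec_mem_Icc μ j)
  have hi1 : Integrable (fun S : Fin m → ι → Bool => |empiricalMean S j - meanVec μ j|)
      (Measure.pi fun _ : Fin m => μ) :=
    integrable_of_measurable_of_mem_Icc hmeas.abs fun S => ⟨abs_nonneg _, hb S⟩
  have hi2 : Integrable (fun S : Fin m → ι → Bool => (empiricalMean S j - meanVec μ j) ^ 2)
      (Measure.pi fun _ : Fin m => μ) :=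
    integrable_of_measurable_of_mem_Icc (hmeas.pow_const 2) fun S =>
      ⟨sq_nonneg _, (sq_le_one_iff_abs_le_one _).2 (hb S)⟩
  calc ∫ S, |empiricalMean S j - meanVec μ j| ∂(Measure.pi fun _ : Fin m => μ)
      ≤ ∫ S, (√m / 2 * (empiricalMean S j - meanVec μ j) ^ 2 + 1 / (2 * √m))
          ∂(Measure.pi fun _ : Fin m => μ) := by
        refine integral_mono hi1 ((hi2.const_mul _).add (integrable_const _)) fun S => ?_
        have h := sq_nonneg (√m * |empiricalMean S j - meanVec μ j| - 1)
        have h2 := sq_abs (empiricalMean S j - meanVec μ j)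
        simp only
        rw [← h2, ← sub_nonneg]
        have : √m / 2 * |empiricalMean S j - meanVec μ j| ^ 2 + 1 / (2 * √m) -
            |empiricalMean S j - meanVec μ j| =
            (√m * |empiricalMean S j - meanVec μ j| - 1) ^ 2 / (2 * √m) := by
          field_simp
          ring
        rw [this]
        positivity
    _ = √m / 2 * ∫ S, (empiricalMean S j - meanVec μ j) ^ 2 ∂(Measure.pi fun _ : Fin m => μ)
          + 1 / (2 * √m) := by
        rw [integral_add (hi2.const_mul _) (integrable_const _), integral_const_mul]
        simp
    _ ≤ √m / 2 * (1 / m) + 1 / (2 * √m) := by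
        gcongr
        exact integral_sq_empiricalMean_sub_le μ hm j
    _ = 1 / √m := by
        nth_rewrite 2 [← Real.sq_sqrt (Nat.cast_nonneg (α := ℝ) m)]
        field_simp
        norm_num

end Empirical

section Splitting

lemma measurePreserving_comp_injective {ι κ X : Type*} [Fintype ι] [Fintype κ]
    [MeasurableSpace X] (μ : Measure X) [IsProbabilityMeasure μ] {h : κ → ι}
    (hh : Function.Injective h) :
    MeasurePreserving (fun S : ι → X => S ∘ h) (Measure.pi fun _ => μ) (Measure.pi fun _ => μ) := by
  classical
  have hm : Measurable fun S : ι → X => S ∘ h :=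
    measurable_pi_lambda _ fun i => measurable_pi_apply (h i)
  refine ⟨hm, (Measure.pi_eq fun s hs => ?_).symm⟩
  rw [Measure.map_apply hm (MeasurableSet.univ_pi hs)]
  have : (fun S : ι → X => S ∘ h) ⁻¹' Set.univ.pi s =
      Set.univ.pi fun i => ⋂ (k : κ) (_ : h k = i), s k := by
    ext S
    simp only [Set.mem_preimage, Set.mem_univ_pi, Set.mem_iInter, Function.comp_apply]
    exact ⟨fun H i k hk => hk ▸ H k, fun H k => H _ k rfl⟩
  rw [this, Measure.pi_pi]
  have hk (k : κ) : (⋂ (k' : κ) (_ : h k' = h k), s k') = s k := by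
    ext x
    simp only [Set.mem_iInter]
    exact ⟨fun H => H k rfl, fun H k' e => hh e ▸ H⟩
  rw [← Finset.prod_subset (Finset.subset_univ (Finset.univ.image h)),
    Finset.prod_image (fun _ _ _ _ e => hh e)]
  · simp_rw [hk]
  · intro i _ hi
    have : (⋂ (k : κ) (_ : h k = i), s k) = Set.univ := by
      simp only [Set.iInter_eq_univ]
      intro k e
      exact (hi (Finset.mem_image.2 ⟨k, Finset.mem_univ _, e⟩)).elim
    rw [this, measure_univ]

/-- The first `n / 2` and the next `n / 2` points of a sample of size `n`. -/
def splitSample {X : Type*} (n : ℕ) (S : Fin n → X) : (Fin (n / 2) → X) × (Fin (n / 2) → X) :=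
  (fun i => S ⟨i, by omega⟩, fun i => S ⟨n / 2 + i, by omega⟩)

lemma measurePreserving_splitSample {X : Type*} [MeasurableSpace X] (μ : Measure X)
    [IsProbabilityMeasure μ] (n : ℕ) :
    MeasurePreserving (splitSample (X := X) n) (Measure.pi fun _ => μ)
      ((Measure.pi fun _ => μ).prod (Measure.pi fun _ => μ)) := by
  let h : Fin (n / 2) ⊕ Fin (n / 2) → Fin n :=
    Sum.elim (fun i => ⟨i, by omega⟩) (fun i => ⟨n / 2 + i, by omega⟩)
  have hh : Function.Injective h := by
    rintro (a | a) (b | b) e <;> simp only [h, Sum.elim_inl, Sum.elim_inr, Fin.mk.injEq] at e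
    · rw [Fin.ext e]
    · omega
    · omega
    · rw [Fin.ext (Nat.add_left_cancel e)]
  exact (measurePreserving_sumPiEquivProdPi (fun _ : Fin (n / 2) ⊕ Fin (n / 2) => μ)).comp
    (measurePreserving_comp_injective μ hh)

end Splitting

section Combination

/-- Select one of the first `k + 1` estimators, trained on the first half of the sample, using the
empirical frequencies of the second half. -/
noncomputable def combinedEstimator (A : ℕ → (n : ℕ) → (Fin n → (ℕ → Bool)) → ℕ → ℝ)
    (k : ℕ → ℕ) (n : ℕ) (S : Fin n → ℕ → Bool) : ℕ → ℝ :=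
  A (selectedIndex (k (n / 2)) (fun i => A i (n / 2) (splitSample n S).1)
    (empiricalMean (splitSample n S).2)) (n / 2) (splitSample n S).1

variable {A : ℕ → (n : ℕ) → (Fin n → (ℕ → Bool)) → ℕ → ℝ}

lemma measurable_selected_estimator (hA : ∀ i n, Measurable (A i n)) (k m : ℕ) :
    Measurable fun x : (Fin m → ℕ → Bool) × (Fin m → ℕ → Bool) =>
      A (selectedIndex k (fun i => A i m x.1) (empiricalMean x.2)) m x.1 :=
  (measurable_selected k).comp <|
    (measurable_pi_lambda (fun (x : (Fin m → ℕ → Bool) × (Fin m → ℕ → Bool)) i => A i m x.1)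
      fun i => (hA i m).comp measurable_fst).prodMk
    (measurable_empiricalMean.comp measurable_snd)

lemma measurable_combinedEstimator (hA : ∀ i n, Measurable (A i n)) (k : ℕ → ℕ) (n : ℕ) :
    Measurable (combinedEstimator A k n) :=
  (measurable_selected_estimator hA (k (n / 2)) (n / 2)).comp
    ((measurable_pi_lambda _ fun _ => measurable_pi_apply _).prodMk
      (measurable_pi_lambda _ fun _ => measurable_pi_apply _))

lemma integral_supDist_combinedEstimator_le (hA : ∀ i n, Measurable (A i n))
    (hAb : ∀ i n S j, A i n S j ∈ Set.Icc (0 : ℝ) 1) (k : ℕ → ℕ) {n i : ℕ} (hn : 0 < n / 2)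
    (hi : i ≤ k (n / 2)) (μ : Measure (ℕ → Bool)) [IsProbabilityMeasure μ] :
    ∫ S, supDist (combinedEstimator A k n S) (meanVec μ) ∂(Measure.pi fun _ : Fin n => μ) ≤
      5 * ∫ S, supDist (A i (n / 2) S) (meanVec μ) ∂(Measure.pi fun _ : Fin (n / 2) => μ) +
        4 * (((k (n / 2) : ℝ) + 1) ^ 2 / √(n / 2 : ℕ)) := by
  have hsplit := measurePreserving_splitSample μ n
  simp only [combinedEstimator]
  generalize splitSample (X := ℕ → Bool) n = f at hsplit ⊢
  generalize n / 2 = m at *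
  have hq := meanVec_mem_Icc μ
  let F : (Fin m → ℕ → Bool) × (Fin m → ℕ → Bool) → ℝ := fun x =>
    supDist (A (selectedIndex (k m) (fun i => A i m x.1) (empiricalMean x.2)) m x.1) (meanVec μ)
  have hF : Measurable F := measurable_supDist.comp
    ((measurable_selected_estimator hA (k m) m).prodMk measurable_const)
  have hdist (p : ℕ → ℝ) (hp : ∀ j, p j ∈ Set.Icc (0 : ℝ) 1) :
      supDist p (meanVec μ) ∈ Set.Icc (0 : ℝ) 1 :=
    ⟨supDist_nonneg _ _, supDist_le fun j => abs_sub_le_one_of_mem_Icc (hp j) (hq j)⟩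
  have hFb (x) : F x ∈ Set.Icc (0 : ℝ) 1 := hdist _ (hAb _ _ _)
  have hFint : Integrable F
      ((Measure.pi fun _ : Fin m => μ).prod (Measure.pi fun _ : Fin m => μ)) :=
    integrable_of_measurable_of_mem_Icc hF hFb
  have hη : Integrable (fun S => supDist (A i m S) (meanVec μ)) (Measure.pi fun _ : Fin m => μ) :=
    integrable_of_measurable_of_mem_Icc
      (measurable_supDist.comp ((hA i m).prodMk measurable_const)) fun S => hdist _ (hAb i m S)
  have herr (j : ℕ) : Integrable (fun S : Fin m → ℕ → Bool => |empiricalMean S j - meanVec μ j|)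
      (Measure.pi fun _ : Fin m => μ) :=
    integrable_of_measurable_of_mem_Icc
      (((measurable_pi_apply j).comp measurable_empiricalMean).sub_const _).abs
      fun S => ⟨abs_nonneg _, abs_sub_le_one_of_mem_Icc (empiricalMean_mem_Icc S j) (hq j)⟩
  have hinner (S : Fin m → ℕ → Bool) : ∫ T, F (S, T) ∂(Measure.pi fun _ : Fin m => μ) ≤
      5 * supDist (A i m S) (meanVec μ) + 4 * (((k m : ℝ) + 1) ^ 2 / √m) := by
    let J : Fin (k m + 1) × Fin (k m + 1) → ℕ := fun b =>
      discrepancyIndex (A b.1 m S) (A b.2 m S)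
    have hsum : Integrable (fun T : Fin m → ℕ → Bool =>
        ∑ b, |empiricalMean T (J b) - meanVec μ (J b)|) (Measure.pi fun _ : Fin m => μ) :=
      integrable_finsetSum _ fun b _ => herr (J b)
    calc ∫ T, F (S, T) ∂(Measure.pi fun _ : Fin m => μ)
        ≤ ∫ T, (5 * supDist (A i m S) (meanVec μ) +
            4 * ∑ b, |empiricalMean T (J b) - meanVec μ (J b)|)
            ∂(Measure.pi fun _ : Fin m => μ) := by
          refine integral_mono (integrable_of_measurable_of_mem_Icc
            (hF.comp measurable_prodMk_left) fun T => hFb (S, T))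
            ((integrable_const _).add (hsum.const_mul 4)) fun T => ?_
          exact supDist_selected_le (P := fun i => A i m S) hi (fun a => hAb a m S) hq
            (empiricalMean_mem_Icc T)
      _ = 5 * supDist (A i m S) (meanVec μ) + 4 * ∑ b,
            ∫ T, |empiricalMean T (J b) - meanVec μ (J b)| ∂(Measure.pi fun _ : Fin m => μ) := by
          rw [integral_add (integrable_const _) (hsum.const_mul 4), integral_const_mul 4,
            integral_finsetSum _ fun b _ => herr (J b)]
          simp
      _ ≤ 5 * supDist (A i m S) (meanVec μ) +
            4 * ∑ _b : Fin (k m + 1) × Fin (k m + 1), 1 / √m := by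
          gcongr with b
          exact integral_abs_empiricalMean_sub_le μ hn (J b)
      _ = 5 * supDist (A i m S) (meanVec μ) + 4 * (((k m : ℝ) + 1) ^ 2 / √m) := by
          simp only [Finset.sum_const, Finset.card_univ, Fintype.card_prod, Fintype.card_fin,
            nsmul_eq_mul]
          push_cast
          ring
  calc ∫ S, F (f S) ∂(Measure.pi fun _ : Fin n => μ)
      = ∫ x, F x ∂((Measure.pi fun _ : Fin m => μ).prod (Measure.pi fun _ : Fin m => μ)) := by
        rw [← hsplit.map_eq, integral_map hsplit.measurable.aemeasurable
          hF.aestronglyMeasurable]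
    _ = ∫ S, ∫ T, F (S, T) ∂(Measure.pi fun _ : Fin m => μ) ∂(Measure.pi fun _ : Fin m => μ) :=
        integral_prod _ hFint
    _ ≤ ∫ S, (5 * supDist (A i m S) (meanVec μ) + 4 * (((k m : ℝ) + 1) ^ 2 / √m))
          ∂(Measure.pi fun _ : Fin m => μ) :=
        integral_mono hFint.integral_prod_left ((hη.const_mul 5).add (integrable_const _)) hinner
    _ = 5 * ∫ S, supDist (A i m S) (meanVec μ) ∂(Measure.pi fun _ : Fin m => μ) +
          4 * (((k m : ℝ) + 1) ^ 2 / √m) := by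
        rw [integral_add (hη.const_mul 5) (integrable_const _), integral_const_mul]
        simp

lemma tendsto_floor_rpow_sq_div_sqrt :
    Tendsto (fun m : ℕ => ((⌊(m : ℝ) ^ (1 / 8 : ℝ)⌋₊ : ℝ) + 1) ^ 2 / √m) atTop (nhds 0) := by
  have hlim : Tendsto (fun m : ℕ => 4 * (m : ℝ) ^ (-(1 / 4) : ℝ)) atTop (nhds 0) := by
    simpa using ((tendsto_rpow_neg_atTop (show (0 : ℝ) < 1 / 4 by norm_num)).comp
      tendsto_natCast_atTop_atTop).const_mul 4
  refine squeeze_zero' (Eventually.of_forall fun m => by positivity) ?_ hlim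
  filter_upwards [eventually_ge_atTop 1] with m hm
  have hm1 : (1 : ℝ) ≤ m := by exact_mod_cast hm
  have hm0 : (0 : ℝ) < m := by linarith
  have hr1 : 1 ≤ (m : ℝ) ^ (1 / 8 : ℝ) := Real.one_le_rpow hm1 (by norm_num)
  have hfl : (⌊(m : ℝ) ^ (1 / 8 : ℝ)⌋₊ : ℝ) ≤ (m : ℝ) ^ (1 / 8 : ℝ) :=
    Nat.floor_le (by positivity)
  have hsq : ((m : ℝ) ^ (1 / 8 : ℝ)) ^ 2 = (m : ℝ) ^ (-(1 / 4) : ℝ) * √m := by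
    rw [Real.sqrt_eq_rpow, ← Real.rpow_add hm0, ← Real.rpow_natCast, ← Real.rpow_mul hm0.le]
    norm_num
  rw [div_le_iff₀ (Real.sqrt_pos.2 hm0), mul_assoc, ← hsq]
  calc ((⌊(m : ℝ) ^ (1 / 8 : ℝ)⌋₊ : ℝ) + 1) ^ 2 ≤ (2 * (m : ℝ) ^ (1 / 8 : ℝ)) ^ 2 := by
        gcongr
        linarith
    _ = 4 * ((m : ℝ) ^ (1 / 8 : ℝ)) ^ 2 := by ring

end Combination

/-- UME-learnability is closed under countable unions: if each collection `Q i` of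
probability measures on `{0,1}^ℕ` is UME-learnable, then so is `⋃ i, Q i`. -/
theorem UMELearnable_iUnion (Q : ℕ → Set (Measure (ℕ → Bool)))
    (hQprob : ∀ i, ∀ μ ∈ Q i, IsProbabilityMeasure μ)
    (hQlearn : ∀ i, UMELearnable (Q i)) :
    UMELearnable (⋃ i, Q i) := by
  choose A hA hAb hAlim using hQlearn
  let k : ℕ → ℕ := fun m => ⌊(m : ℝ) ^ (1 / 8 : ℝ)⌋₊
  have hk : Tendsto k atTop atTop := tendsto_nat_floor_atTop.comp
    ((tendsto_rpow_atTop (by norm_num)).comp tendsto_natCast_atTop_atTop)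
  refine ⟨combinedEstimator A k, measurable_combinedEstimator hA k,
    fun n S j => hAb _ _ _ _, fun μ hμ => ?_⟩
  obtain ⟨i, hi⟩ := Set.mem_iUnion.1 hμ
  have := hQprob i μ hi
  have hhalf : Tendsto (fun n : ℕ => n / 2) atTop atTop :=
    Nat.tendsto_div_const_atTop (by norm_num)
  have hlim := (((hAlim i μ hi).const_mul 5).add
    (tendsto_floor_rpow_sq_div_sqrt.const_mul 4)).comp hhalf
  rw [mul_zero, mul_zero, add_zero] at hlim
  refine squeeze_zero' (Eventually.of_forall fun n =>
    integral_nonneg fun S => supDist_nonneg _ _) ?_ hlim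
  filter_upwards [hhalf.eventually_gt_atTop 0, hhalf.eventually (hk.eventually_ge_atTop i)]
    with n hn hin
  exact integral_supDist_combinedEstimator_le hA hAb k hn hin μ
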